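/- arXiv:1704.04350 — 2 statements merged into one kernel-verified Lean document; each statement's English description precedes it below -/
import Mathlib

section
/- Let f : [1,∞) → [1,∞) be an increasing function such that t ↦ f(t)·t^{-1/2} is decreasing and ∫₁^∞ da/(a·f(a)) < ∞, and set g(t) := (∫_t^∞ da/(a·f(a)))⁻¹ for t ≥ 1. Then for every constant c ≥ 1 and every t ≥ 1 one has g(t) ≤ g(c·t) ≤ (1 + (√c·log c)/2)·g(t); in particular g(c·t) ≈ g(t) uniformly in t for each fixed c > 0. -/
open MeasureTheory Set Filter

/-- Lower bound for the tail integral of `1 / (a f(a))` when `f(a) a^{-1/2}` is at most its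
value at `t ≤ s`. -/
theorem two_mul_rpow_div_le_integral_Ioi_inv {f : ℝ → ℝ} {s t : ℝ} (hs : 0 < s) (hts : t ≤ s)
    (hpos : ∀ a ∈ Ioi s, 0 < f a)
    (hdec : ∀ a ∈ Ici t, f a * a ^ (-(1/2) : ℝ) ≤ f t * t ^ (-(1/2) : ℝ))
    (hint : IntegrableOn (fun a => (a * f a)⁻¹) (Ioi s)) :
    2 * s ^ (-(1/2) : ℝ) * (f t * t ^ (-(1/2) : ℝ))⁻¹ ≤ ∫ a in Ioi s, (a * f a)⁻¹ := by
  have hrpow : (-(3/2) : ℝ) < -1 := by norm_num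
  have hval : ∫ a in Ioi s, a ^ (-(3/2) : ℝ) * (f t * t ^ (-(1/2) : ℝ))⁻¹
      = 2 * s ^ (-(1/2) : ℝ) * (f t * t ^ (-(1/2) : ℝ))⁻¹ := by
    rw [integral_mul_const, integral_Ioi_rpow_of_lt hrpow hs]
    norm_num
    left
    ring
  rw [← hval]
  refine setIntegral_mono_on ((integrableOn_Ioi_rpow_of_lt hrpow hs).mul_const _) hint
    measurableSet_Ioi fun a ha => ?_
  have ha0 : 0 < a := hs.trans ha
  have hfa := hpos a ha
  have hrp : 0 < a ^ (-(1/2) : ℝ) := Real.rpow_pos_of_pos ha0 _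
  have hsplit : a ^ (-(3/2) : ℝ) = a⁻¹ * a ^ (-(1/2) : ℝ) := by
    rw [← Real.rpow_neg_one, ← Real.rpow_add ha0]
    norm_num
  calc a ^ (-(3/2) : ℝ) * (f t * t ^ (-(1/2) : ℝ))⁻¹
      ≤ a ^ (-(3/2) : ℝ) * (f a * a ^ (-(1/2) : ℝ))⁻¹ := by
        refine mul_le_mul_of_nonneg_left ?_ (Real.rpow_nonneg ha0.le _)
        exact inv_anti₀ (mul_pos hfa hrp) (hdec a (hts.trans (le_of_lt ha)))
    _ = (a * f a)⁻¹ := by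
        rw [hsplit]
        field_simp

/-- Upper bound for the integral of `1 / (a f(a))` over `(t, s]` when `f ≥ f(t) > 0` there. -/
theorem integral_Ioc_inv_le_log_div {f : ℝ → ℝ} {s t : ℝ} (ht : 0 < t) (hts : t ≤ s)
    (hft : 0 < f t) (hmono : ∀ a ∈ Ioc t s, f t ≤ f a)
    (hint : IntegrableOn (fun a => (a * f a)⁻¹) (Ioc t s)) :
    ∫ a in Ioc t s, (a * f a)⁻¹ ≤ Real.log (s / t) / f t := by
  have hval : ∫ a in Ioc t s, a⁻¹ * (f t)⁻¹ = Real.log (s / t) / f t := by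
    rw [integral_mul_const, ← intervalIntegral.integral_of_le hts,
      integral_inv_of_pos ht (ht.trans_le hts), div_eq_mul_inv _ (f t)]
  have hinv : IntegrableOn (fun a : ℝ => a⁻¹) (Ioc t s) := by
    rw [← intervalIntegrable_iff_integrableOn_Ioc_of_le hts]
    refine intervalIntegral.intervalIntegrable_inv (fun a ha => ?_) continuousOn_id
    rw [uIcc_of_le hts] at ha
    exact (ht.trans_le ha.1).ne'
  rw [← hval]
  refine setIntegral_mono_on hint (hinv.mul_const _) measurableSet_Ioc fun a ha => ?_
  have ha0 : 0 < a := ht.trans ha.1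
  rw [mul_inv]
  gcongr
  exact hmono a ha

/-- If `f : [1,∞) → [1,∞)` is increasing, `t ↦ f(t) t^{-1/2}` is decreasing and
`∫₁^∞ da/(a f(a)) < ∞`, with `g(t) := (∫_t^∞ da/(a f(a)))⁻¹`, then for every `c ≥ 1`, `t ≥ 1`:
`g(t) ≤ g(c t) ≤ (1 + √c · log c / 2) · g(t)`. -/
theorem stmt_5 (f : ℝ → ℝ)
    (hf_meas : Measurable f)
    (hf_ge : ∀ t ∈ Ici (1:ℝ), 1 ≤ f t)
    (hf_mono : MonotoneOn f (Ici (1:ℝ)))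
    (hf_dec : AntitoneOn (fun t => f t * t ^ (-(1/2) : ℝ)) (Ici (1:ℝ)))
    (hf_int : IntegrableOn (fun a => (a * f a)⁻¹) (Ici (1:ℝ))) :
    ∀ c ∈ Ici (1:ℝ), ∀ t ∈ Ici (1:ℝ),
      (∫ a in Ioi t, (a * f a)⁻¹)⁻¹ ≤ (∫ a in Ioi (c * t), (a * f a)⁻¹)⁻¹ ∧
      (∫ a in Ioi (c * t), (a * f a)⁻¹)⁻¹
        ≤ (1 + Real.sqrt c * Real.log c / 2) * (∫ a in Ioi t, (a * f a)⁻¹)⁻¹ := by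
  intro c hc t ht
  have hc1 : 1 ≤ c := hc
  have ht1 : 1 ≤ t := ht
  have hc0 : 0 < c := by linarith
  have ht0 : 0 < t := by linarith
  have hts : t ≤ c * t := le_mul_of_one_le_left ht0.le hc1
  have hs1 : 1 ≤ c * t := ht1.trans hts
  have hft : 0 < f t := zero_lt_one.trans_le (hf_ge t ht)
  have hpos : ∀ a ∈ Ioi t, 0 < f a := fun a ha =>
    zero_lt_one.trans_le (hf_ge a (ht1.trans (le_of_lt ha)))
  have hint_t : IntegrableOn (fun a => (a * f a)⁻¹) (Ioi t) :=
    hf_int.mono_set fun a ha => ht1.trans (le_of_lt ha)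
  have hint_mid : IntegrableOn (fun a => (a * f a)⁻¹) (Ioc t (c * t)) :=
    hint_t.mono_set Ioc_subset_Ioi_self
  have hint_s : IntegrableOn (fun a => (a * f a)⁻¹) (Ioi (c * t)) :=
    hint_t.mono_set (Ioi_subset_Ioi hts)
  have hsplit : ∫ a in Ioi t, (a * f a)⁻¹
      = (∫ a in Ioc t (c * t), (a * f a)⁻¹) + ∫ a in Ioi (c * t), (a * f a)⁻¹ := by
    rw [← Ioc_union_Ioi_eq_Ioi hts,
      setIntegral_union Ioc_disjoint_Ioi_same measurableSet_Ioi hint_mid hint_s]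
  have hmid_nonneg : 0 ≤ ∫ a in Ioc t (c * t), (a * f a)⁻¹ := by
    refine setIntegral_nonneg measurableSet_Ioc fun a ha => ?_
    exact inv_nonneg.2 (mul_pos (ht0.trans ha.1) (hpos a ha.1)).le
  have hmid : ∫ a in Ioc t (c * t), (a * f a)⁻¹ ≤ Real.log c / f t := by
    have h := integral_Ioc_inv_le_log_div ht0 hts hft
      (fun a ha => hf_mono ht (ht1.trans ha.1.le) ha.1.le) hint_mid
    rwa [mul_div_cancel_right₀ c ht0.ne'] at h
  have htail : 2 / (Real.sqrt c * f t) ≤ ∫ a in Ioi (c * t), (a * f a)⁻¹ := by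
    have h := two_mul_rpow_div_le_integral_Ioi_inv (by linarith) hts
      (fun a ha => hpos a (hts.trans_lt ha))
      (fun a (ha : t ≤ a) => hf_dec ht (ht1.trans ha) ha) hint_s
    refine le_of_eq_of_le ?_ h
    have htr : 0 < t ^ (-(1/2) : ℝ) := Real.rpow_pos_of_pos ht0 _
    have hsq : 0 < Real.sqrt c := Real.sqrt_pos.2 hc0
    rw [Real.mul_rpow hc0.le ht0.le, Real.rpow_neg hc0.le, ← Real.sqrt_eq_rpow]
    field_simp
  have hsq : 0 < Real.sqrt c := Real.sqrt_pos.2 hc0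
  have hlog : 0 ≤ Real.log c := Real.log_nonneg hc1
  have htail_pos : 0 < ∫ a in Ioi (c * t), (a * f a)⁻¹ := lt_of_lt_of_le (by positivity) htail
  have hbound : Real.log c / f t
      ≤ Real.sqrt c * Real.log c / 2 * ∫ a in Ioi (c * t), (a * f a)⁻¹ := by
    calc Real.log c / f t
        = Real.sqrt c * Real.log c / 2 * (2 / (Real.sqrt c * f t)) := by field_simp
      _ ≤ _ := by gcongr
  rw [hsplit]
  constructor
  · gcongr
    linarith
  · rw [← div_eq_mul_inv, le_div_iff₀ (by linarith), inv_mul_le_iff₀ htail_pos]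
    linarith
end

section
/- Let Ω ⊂ ℂⁿ be a bounded open set, let g : [1,∞) → [1,∞) be increasing with g ≥ 1 (extended by g(s) := g(1) for 0 < s < 1) and satisfying g(c·t) ≤ K_c·g(t) for every c ≥ 1, t ≥ 1, with constants K_c independent of t, let β > 0, and let u : Ω̄ → ℝ be continuous. Assume there are constants C > 0 and δ₀ > 0 such that for every 0 < δ ≤ δ₀: (i) |u(z) − u(z')| ≤ C·g(δ⁻¹)^{-β} whenever z, z' ∈ Ω̄ satisfy dist(z, ∂Ω) ≤ δ, dist(z', ∂Ω) ≤ δ and |z − z'| < δ; and (ii) sup_{|ζ| < δ/2} u(z + ζ) − u(z) ≤ C·g(δ⁻¹)^{-β} for every z ∈ Ω with dist(z, ∂Ω) > δ. Then there is a constant C' > 0 such that |u(z) − u(z')| ≤ C'·g(|z − z'|⁻¹)^{-β} for all z, z' ∈ Ω̄ with z ≠ z'; in particular u belongs to the g^β-Hölder space Λ^{g^β}(Ω̄). -/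
open Set
open scoped ENNReal

/-- `g` extended below `1` by the constant value `g 1`. -/
noncomputable def gExt (g : ℝ → ℝ) (s : ℝ) : ℝ := if s < 1 then g 1 else g s

/-- The `h`-Hölder norm `‖u‖_{Λ^h(A)} = ‖u‖_{L^∞(A)} + sup_{z ≠ w ∈ A} h(|z-w|⁻¹)|u z - u w|`,
valued in `ℝ≥0∞`. -/
noncomputable def lamNorm (n : ℕ) (h : ℝ → ℝ) (A : Set (EuclideanSpace ℂ (Fin n)))
    (u : EuclideanSpace ℂ (Fin n) → ℝ) : ℝ≥0∞ :=
  (⨆ z ∈ A, ENNReal.ofReal |u z|) +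
    ⨆ z ∈ A, ⨆ w ∈ A, ⨆ _ : z ≠ w, ENNReal.ofReal (h (‖z - w‖⁻¹) * |u z - u w|)

lemma one_le_gExt {g : ℝ → ℝ} (hg_ge : ∀ t ∈ Ici (1 : ℝ), 1 ≤ g t) (s : ℝ) : 1 ≤ gExt g s := by
  unfold gExt
  split_ifs with h
  · exact hg_ge 1 self_mem_Ici
  · exact hg_ge s (not_lt.1 h)

lemma monotone_gExt {g : ℝ → ℝ} (hg_mono : MonotoneOn g (Ici (1 : ℝ))) : Monotone (gExt g) := by
  intro s t hst
  unfold gExt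
  split_ifs with hs ht ht
  · exact le_rfl
  · exact hg_mono self_mem_Ici (not_lt.1 ht) (not_lt.1 ht)
  · exact absurd (hst.trans_lt ht) hs
  · exact hg_mono (not_lt.1 hs) (not_lt.1 ht) hst

/-- The extension below `1` of a doubling function is doubling. -/
lemma exists_gExt_mul_le {g : ℝ → ℝ} (hg_ge : ∀ t ∈ Ici (1 : ℝ), 1 ≤ g t)
    (hg_mono : MonotoneOn g (Ici (1 : ℝ)))
    (hg_doub : ∀ c : ℝ, 1 ≤ c → ∃ K : ℝ, ∀ t ∈ Ici (1 : ℝ), g (c * t) ≤ K * g t)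
    {c : ℝ} (hc : 1 ≤ c) : ∃ K > (0 : ℝ), ∀ s, gExt g (c * s) ≤ K * gExt g s := by
  obtain ⟨K, hK⟩ := hg_doub c hc
  have hone : g c ≤ K * g 1 := by simpa using hK 1 self_mem_Ici
  have hK0 : 0 < K := by
    have := hg_ge c hc
    have := hg_ge 1 self_mem_Ici
    by_contra! h
    nlinarith
  refine ⟨K, hK0, fun s => ?_⟩
  rcases lt_or_ge s 1 with hs | hs
  · calc gExt g (c * s) ≤ gExt g c := monotone_gExt hg_mono (by nlinarith)
      _ = g c := if_neg hc.not_gt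
      _ ≤ K * g 1 := hone
      _ = K * gExt g s := by rw [gExt, if_pos hs]
  · rw [gExt, if_neg (by nlinarith), gExt, if_neg hs.not_gt]
    exact hK s hs

lemma Real.rpow_neg_le_mul_rpow_neg {a b K β : ℝ} (ha : 0 < a) (hb : 0 < b) (hK : 0 < K)
    (hβ : 0 ≤ β) (h : a ≤ K * b) : b ^ (-β) ≤ K ^ β * a ^ (-β) := by
  rw [Real.rpow_neg ha.le, Real.rpow_neg hb.le, ← div_eq_mul_inv,
    inv_le_comm₀ (by positivity) (by positivity), inv_div, div_le_iff₀ (by positivity), mul_comm,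
    ← Real.mul_rpow hK.le hb.le]
  exact Real.rpow_le_rpow ha.le h hβ

/-- A bounded function satisfying the pointwise `h`-Hölder estimate has finite `h`-Hölder norm. -/
lemma lamNorm_lt_top {n : ℕ} {h : ℝ → ℝ} {A : Set (EuclideanSpace ℂ (Fin n))}
    {u : EuclideanSpace ℂ (Fin n) → ℝ} {M L : ℝ} (hM : ∀ z ∈ A, |u z| ≤ M)
    (hL : ∀ z ∈ A, ∀ w ∈ A, z ≠ w → h (‖z - w‖⁻¹) * |u z - u w| ≤ L) :
    lamNorm n h A u < ⊤ := by
  refine ENNReal.add_lt_top.2 ⟨lt_of_le_of_lt ?_ (ENNReal.ofReal_lt_top (r := M)),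
    lt_of_le_of_lt ?_ (ENNReal.ofReal_lt_top (r := L))⟩
  · exact iSup₂_le fun z hz => ENNReal.ofReal_le_ofReal (hM z hz)
  · exact iSup₂_le fun z hz => iSup₂_le fun w hw => iSup_le fun hzw =>
      ENNReal.ofReal_le_ofReal (hL z hz w hw hzw)

lemma IsOpen.mem_of_mem_closure_of_infDist_frontier_pos {X : Type*} [PseudoMetricSpace X]
    {Ω : Set X} (hΩ : IsOpen Ω) {z : X} (hz : z ∈ closure Ω)
    (hd : 0 < Metric.infDist z (frontier Ω)) : z ∈ Ω := by
  by_contra h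
  have hf : z ∈ frontier Ω := hΩ.frontier_eq ▸ ⟨hz, h⟩
  exact hd.ne' (Metric.infDist_zero_of_mem hf)

/-- A modulus near the boundary and a one-sided modulus in the interior give a two-sided modulus
on the closure, at a comparable scale. -/
lemma abs_sub_le_of_frontier_of_interior {E : Type*} [NormedAddCommGroup E] {Ω : Set E}
    (hΩ : IsOpen Ω) {u : E → ℝ} {ω : ℝ → ℝ} {δ₀ : ℝ} (hω : MonotoneOn ω (Ioi 0))
    (h_bdry : ∀ δ : ℝ, 0 < δ → δ ≤ δ₀ → ∀ z ∈ closure Ω, ∀ z' ∈ closure Ω,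
      Metric.infDist z (frontier Ω) ≤ δ → Metric.infDist z' (frontier Ω) ≤ δ →
      ‖z - z'‖ < δ → |u z - u z'| ≤ ω δ)
    (h_int : ∀ δ : ℝ, 0 < δ → δ ≤ δ₀ → ∀ z ∈ Ω, δ < Metric.infDist z (frontier Ω) →
      ∀ ζ : E, ‖ζ‖ < δ / 2 → u (z + ζ) - u z ≤ ω δ)
    {z z' : E} (hz : z ∈ closure Ω) (hz' : z' ∈ closure Ω) (hne : z ≠ z')
    (hδ : 4 * ‖z - z'‖ ≤ δ₀) : |u z - u z'| ≤ ω (4 * ‖z - z'‖) := by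
  have hr : 0 < ‖z - z'‖ := norm_pos_iff.2 (sub_ne_zero.2 hne)
  have h1 := Metric.infDist_le_infDist_add_dist (s := frontier Ω) (x := z) (y := z')
  have h2 := Metric.infDist_le_infDist_add_dist (s := frontier Ω) (x := z') (y := z)
  rw [dist_eq_norm] at h1
  rw [dist_comm, dist_eq_norm] at h2
  by_cases hnear : Metric.infDist z (frontier Ω) ≤ 4 * ‖z - z'‖ ∧
      Metric.infDist z' (frontier Ω) ≤ 4 * ‖z - z'‖
  · exact h_bdry _ (by positivity) hδ z hz z' hz' hnear.1 hnear.2 (by linarith)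
  have hfar : 3 * ‖z - z'‖ < Metric.infDist z (frontier Ω) ∧
      3 * ‖z - z'‖ < Metric.infDist z' (frontier Ω) := by
    rw [not_and_or, not_le, not_le] at hnear
    rcases hnear with h | h <;> constructor <;> linarith
  have hzΩ := hΩ.mem_of_mem_closure_of_infDist_frontier_pos hz (by linarith [hfar.1])
  have hz'Ω := hΩ.mem_of_mem_closure_of_infDist_frontier_pos hz' (by linarith [hfar.2])
  have e1 := h_int (3 * ‖z - z'‖) (by positivity) (by linarith) z hzΩ hfar.1 (z' - z)
    (by rw [norm_sub_rev]; linarith)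
  have e2 := h_int (3 * ‖z - z'‖) (by positivity) (by linarith) z' hz'Ω hfar.2 (z - z')
    (by linarith)
  rw [add_sub_cancel] at e1 e2
  have hmono : ω (3 * ‖z - z'‖) ≤ ω (4 * ‖z - z'‖) :=
    hω (mem_Ioi.2 (by positivity)) (mem_Ioi.2 (by positivity)) (by linarith)
  exact abs_le.2 ⟨by linarith, by linarith⟩

/-- gluing step. Combining (i) the near-boundary two-point estimate and
(ii) the interior sup-convolution estimate, a continuous `u` on `Ω̄` satisfies the global
`g^β`-Hölder estimate `|u z - u z'| ≤ C' g(|z-z'|⁻¹)^{-β}`; in particular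
`u ∈ Λ^{g^β}(Ω̄)`. -/
theorem stmt_10 (n : ℕ) (Ω : Set (EuclideanSpace ℂ (Fin n)))
    (hΩo : IsOpen Ω) (hΩb : Bornology.IsBounded Ω)
    (g : ℝ → ℝ) (hg_ge : ∀ t ∈ Ici (1:ℝ), 1 ≤ g t)
    (hg_mono : MonotoneOn g (Ici (1:ℝ)))
    (hg_doub : ∀ c : ℝ, 1 ≤ c → ∃ K : ℝ, ∀ t ∈ Ici (1:ℝ), g (c * t) ≤ K * g t)
    (β : ℝ) (hβ : 0 < β)
    (u : EuclideanSpace ℂ (Fin n) → ℝ) (hu_cont : ContinuousOn u (closure Ω))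
    (C δ₀ : ℝ) (hC : 0 < C) (hδ₀ : 0 < δ₀)
    (h_bdry : ∀ δ : ℝ, 0 < δ → δ ≤ δ₀ →
      ∀ z ∈ closure Ω, ∀ z' ∈ closure Ω,
        Metric.infDist z (frontier Ω) ≤ δ → Metric.infDist z' (frontier Ω) ≤ δ →
        ‖z - z'‖ < δ → |u z - u z'| ≤ C * (gExt g δ⁻¹) ^ (-β))
    (h_int : ∀ δ : ℝ, 0 < δ → δ ≤ δ₀ →
      ∀ z ∈ Ω, δ < Metric.infDist z (frontier Ω) →
        ∀ ζ : EuclideanSpace ℂ (Fin n), ‖ζ‖ < δ / 2 →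
          u (z + ζ) - u z ≤ C * (gExt g δ⁻¹) ^ (-β)) :
    (∃ C' > (0:ℝ), ∀ z ∈ closure Ω, ∀ z' ∈ closure Ω, z ≠ z' →
      |u z - u z'| ≤ C' * (gExt g (‖z - z'‖⁻¹)) ^ (-β)) ∧
    lamNorm n (fun s => gExt g s ^ β) (closure Ω) u < ⊤ := by
  have hpos : ∀ s, 0 < gExt g s := fun s => one_pos.trans_le (one_le_gExt hg_ge s)
  obtain ⟨M, hM⟩ := hΩb.isCompact_closure.exists_bound_of_continuousOn hu_cont
  simp only [Real.norm_eq_abs] at hM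
  obtain ⟨K, hK0, hK⟩ :=
    exists_gExt_mul_le hg_ge hg_mono hg_doub (by norm_num : (1 : ℝ) ≤ 4)
  have hω : MonotoneOn (fun δ : ℝ => C * gExt g δ⁻¹ ^ (-β)) (Ioi 0) := by
    intro s hs t _ hst
    exact mul_le_mul_of_nonneg_left (Real.rpow_le_rpow_of_nonpos (hpos _)
      (monotone_gExt hg_mono (inv_anti₀ hs hst)) (neg_nonpos.2 hβ.le)) hC.le
  have hB := hpos (4 / δ₀)
  have key : ∃ C' > (0 : ℝ), ∀ z ∈ closure Ω, ∀ z' ∈ closure Ω, z ≠ z' →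
      |u z - u z'| ≤ C' * (gExt g (‖z - z'‖⁻¹)) ^ (-β) := by
    refine ⟨C * K ^ β + 2 * |M| * gExt g (4 / δ₀) ^ β, by positivity,
      fun z hz z' hz' hne => ?_⟩
    have hr : 0 < ‖z - z'‖ := norm_pos_iff.2 (sub_ne_zero.2 hne)
    have hG := hpos (‖z - z'‖⁻¹)
    rw [add_mul]
    rcases le_or_gt (4 * ‖z - z'‖) δ₀ with hδ | hδ
    · have hscale : gExt g ‖z - z'‖⁻¹ ≤ K * gExt g (4 * ‖z - z'‖)⁻¹ := by
        convert hK (4 * ‖z - z'‖)⁻¹ using 2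
        field_simp
      calc |u z - u z'| ≤ C * gExt g (4 * ‖z - z'‖)⁻¹ ^ (-β) :=
            abs_sub_le_of_frontier_of_interior hΩo hω h_bdry h_int hz hz' hne hδ
        _ ≤ C * (K ^ β * gExt g ‖z - z'‖⁻¹ ^ (-β)) :=
            mul_le_mul_of_nonneg_left
              (Real.rpow_neg_le_mul_rpow_neg hG (hpos _) hK0 hβ.le hscale) hC.le
        _ = C * K ^ β * gExt g ‖z - z'‖⁻¹ ^ (-β) := (mul_assoc _ _ _).symm
        _ ≤ _ := le_add_of_nonneg_right (by positivity)
    · have hle : gExt g ‖z - z'‖⁻¹ ≤ gExt g (4 / δ₀) * 1 := by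
        rw [mul_one]
        refine monotone_gExt hg_mono ?_
        rw [inv_le_comm₀ hr (by positivity), inv_div]
        linarith
      have hone := Real.rpow_neg_le_mul_rpow_neg hG one_pos hB hβ.le hle
      rw [Real.one_rpow] at hone
      calc |u z - u z'| ≤ |u z| + |u z'| := abs_sub _ _
        _ ≤ 2 * |M| * 1 := by linarith [hM z hz, hM z' hz', le_abs_self M]
        _ ≤ 2 * |M| * (gExt g (4 / δ₀) ^ β * gExt g ‖z - z'‖⁻¹ ^ (-β)) :=
            mul_le_mul_of_nonneg_left hone (by positivity)
        _ = 2 * |M| * gExt g (4 / δ₀) ^ β * gExt g ‖z - z'‖⁻¹ ^ (-β) :=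
            (mul_assoc _ _ _).symm
        _ ≤ _ := le_add_of_nonneg_left (by positivity)
  refine ⟨key, ?_⟩
  obtain ⟨C', -, hC'⟩ := key
  refine lamNorm_lt_top hM (L := C') fun z hz w hw hzw => ?_
  have hle := hC' z hz w hw hzw
  have hG := hpos (‖z - w‖⁻¹)
  rwa [Real.rpow_neg hG.le, ← div_eq_mul_inv, le_div_iff₀ (by positivity), mul_comm] at hle
end
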